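/- Fix integers m ≥ 2 and k ≥ 2, and let i ≥ 2 be an integer such that i·rad(i) divides m, where rad(i) is the product of the distinct prime divisors of i. Then r_ℳ(i,m,k) = m·φ(m)^{k−2}·∏_{p prime, p ∣ i} C(ν_p(i) + k − 2, ν_p(i)), where ν_p(i) is the p-adic valuation of i, C(·,·) is the binomial coefficient, and φ is Euler's totient function. -/

import Mathlib

/-- `pM m k n` is the number of restricted `m`-ary partitions of `n` with parts
`1, m, m^2, …, m^(k-1)`. -/
noncomputable def pM (m k n : ℕ) : ℕ :=
  Nat.card {x : Fin k → ℕ // ∑ i : Fin k, x i * m ^ (i : ℕ) = n}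

/-- `rM i m k = #{n ∈ {0,…,m^k - 1} : p_ℳ(n,k) ≡ i (mod m)}`. -/
noncomputable def rM (i m k : ℕ) : ℕ :=
  ((Finset.range (m ^ k)).filter (fun n : ℕ => pM m k n % m = i)).card

open Finset

/-- The product of the numbers `⌊n / m ^ j⌋ + 1` for `j < s`; modulo `m` it is the product of the
lowest `s` base-`m` digits of `n`, each increased by one. -/
def digitProd (m s n : ℕ) : ℕ := ∏ j ∈ range s, (n / m ^ j + 1)

lemma digitProd_zero (m n : ℕ) : digitProd m 0 n = 1 := by simp [digitProd]

lemma digitProd_succ (m s n : ℕ) :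
    digitProd m (s + 1) n = (n + 1) * digitProd m s (n / m) := by
  rw [digitProd, prod_range_succ', mul_comm]
  simp [digitProd, pow_succ', Nat.div_div_eq_div_mul]

lemma sum_range_mul (m M : ℕ) (f : ℕ → ℕ) :
    ∑ x ∈ range (m * M), f x = ∑ b ∈ range M, ∑ a ∈ range m, f (m * b + a) := by
  induction M with
  | zero => simp
  | succ M ih => rw [Nat.mul_succ, sum_range_add, sum_range_succ, ih]

lemma finite_restricted_partitions {m : ℕ} (hm : 0 < m) (k n : ℕ) :
    Finite {x : Fin k → ℕ // ∑ i : Fin k, x i * m ^ (i : ℕ) = n} := by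
  refine Set.Finite.to_subtype ((Set.finite_Iic (fun _ : Fin k => n)).subset ?_)
  intro x hx i
  have hx : ∑ i : Fin k, x i * m ^ (i : ℕ) = n := hx
  calc x i ≤ x i * m ^ (i : ℕ) := Nat.le_mul_of_pos_right _ (by positivity)
    _ ≤ ∑ i : Fin k, x i * m ^ (i : ℕ) :=
      single_le_sum (f := fun i : Fin k => x i * m ^ (i : ℕ)) (fun _ _ => Nat.zero_le _)
        (mem_univ i)
    _ = n := hx

lemma sum_fin_succ_mul_pow (m k : ℕ) (x : Fin (k + 1) → ℕ) :
    ∑ i : Fin (k + 1), x i * m ^ (i : ℕ) =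
      x 0 + m * ∑ i : Fin k, x i.succ * m ^ (i : ℕ) := by
  rw [Fin.sum_univ_succ, mul_sum]
  simp only [Fin.val_zero, pow_zero, mul_one, Fin.val_succ]
  congr 1
  exact sum_congr rfl fun i _ => by ring

lemma pM_succ {m : ℕ} (hm : 0 < m) (k n : ℕ) :
    pM m (k + 1) n = ∑ j ∈ range (n / m + 1), pM m k j := by
  rw [← Fin.sum_univ_eq_sum_range (fun j => pM m k j)]
  have := fun j => finite_restricted_partitions hm k j
  simp only [pM]
  rw [← Nat.card_sigma]
  refine Nat.card_congr
    { toFun := fun x => ⟨⟨∑ i : Fin k, x.1 i.succ * m ^ (i : ℕ), ?_⟩,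
        ⟨fun i => x.1 i.succ, rfl⟩⟩
      invFun := fun y => ⟨Fin.cons (n - m * y.1) y.2.1, ?_⟩
      left_inv := ?_
      right_inv := ?_ }
  · have h := x.2
    rw [sum_fin_succ_mul_pow] at h
    rw [Nat.lt_succ_iff, Nat.le_div_iff_mul_le hm, mul_comm]
    omega
  · rw [sum_fin_succ_mul_pow]
    simp only [Fin.cons_zero, Fin.cons_succ, y.2.2]
    have h := y.1.2
    rw [Nat.lt_succ_iff, Nat.le_div_iff_mul_le hm, mul_comm] at h
    omega
  · rintro ⟨x, hx⟩
    rw [sum_fin_succ_mul_pow] at hx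
    apply Subtype.ext
    funext i
    refine Fin.cases ?_ (fun i => ?_) i
    · simp only [Fin.cons_zero]
      omega
    · simp only [Fin.cons_succ]
  · rintro ⟨⟨j, hj⟩, ⟨y, hy⟩⟩
    dsimp only at hy
    subst hy
    rfl

lemma pM_one {m : ℕ} (hm : 0 < m) (n : ℕ) : pM m 1 n = 1 := by
  rw [pM_succ hm, sum_range_succ']
  simp [pM]

lemma sum_range_succ_div_modEq {m : ℕ} (hm : 0 < m) (f : ℕ → ℕ) (N : ℕ) :
    ∑ j ∈ range (N + 1), f (j / m) ≡ (N + 1) * f (N / m) [MOD m] := by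
  have hN : N + 1 = m * (N / m) + (N % m + 1) := by rw [← add_assoc, Nat.div_add_mod]
  have hdiv : ∀ b a, a < m → (m * b + a) / m = b := fun b a ha => by
    rw [Nat.mul_add_div hm, Nat.div_eq_of_lt ha, add_zero]
  have h1 : ∑ j ∈ range (m * (N / m)), f (j / m) = m * ∑ b ∈ range (N / m), f b := by
    rw [sum_range_mul, mul_sum]
    refine sum_congr rfl fun b _ => ?_
    rw [sum_congr rfl fun a ha => by rw [hdiv b a (mem_range.1 ha)]]
    simp
  have h2 : ∑ a ∈ range (N % m + 1), f ((m * (N / m) + a) / m) = (N % m + 1) * f (N / m) := by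
    rw [sum_congr rfl fun a ha => by
      rw [hdiv _ a (lt_of_lt_of_le (mem_range.1 ha) (Nat.mod_lt N hm))]]
    simp
  calc ∑ j ∈ range (N + 1), f (j / m)
      = m * ∑ b ∈ range (N / m), f b + (N % m + 1) * f (N / m) := by
        rw [hN, sum_range_add, h1, h2]
    _ ≡ 0 + (N + 1) * f (N / m) [MOD m] := by
        refine Nat.ModEq.add ?_ (((Nat.mod_modEq N m).add_right 1).mul_right _)
        exact Nat.modEq_zero_iff_dvd.2 (dvd_mul_right _ _)
    _ = (N + 1) * f (N / m) := zero_add _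

/-- Restricted `m`-ary partitions are counted, modulo `m`, by a product of base-`m` digits. -/
lemma pM_succ_modEq_digitProd {m : ℕ} (hm : 0 < m) (k n : ℕ) :
    pM m (k + 1) n ≡ digitProd m k (n / m) [MOD m] := by
  induction k generalizing n with
  | zero => rw [zero_add, pM_one hm, digitProd_zero]
  | succ k ih =>
    rw [pM_succ hm, digitProd_succ]
    refine Nat.ModEq.trans ?_ (sum_range_succ_div_modEq hm (digitProd m k) (n / m))
    generalize n / m + 1 = K
    induction K with
    | zero => rfl
    | succ K ihK => rw [sum_range_succ, sum_range_succ]; exact ihK.add (ih K)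

/-- The linear congruence `x * y ≡ c (mod m)` has either no solution or `gcd m y` of them in a
complete residue system. -/
lemma card_filter_succ_mul_modEq {m : ℕ} (hm : 0 < m) (y c : ℕ) :
    #{a ∈ range m | (a + 1) * y ≡ c [MOD m]} = if m.gcd y ∣ m.gcd c then m.gcd y else 0 := by
  have hd : 0 < m.gcd y := Nat.gcd_pos_of_pos_left y hm
  split_ifs with h
  · obtain ⟨a₀, ha₀⟩ : ∃ a₀, (a₀ + 1) * y ≡ c [MOD m] := by
      obtain ⟨t, ht⟩ := h.trans (Nat.gcd_dvd_right m c)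
      obtain ⟨x, hx⟩ : ∃ x, y * x ≡ m.gcd y [MOD m] := by
        rw [Nat.gcd_comm]
        rcases (Nat.gcd_le_right y hm).lt_or_eq with hlt | heq
        · obtain ⟨x, -, hx⟩ := Nat.exists_mul_mod_eq_gcd hlt
          exact ⟨x, by rw [Nat.ModEq, hx, Nat.mod_eq_of_lt hlt]⟩
        · exact ⟨0, by simp [Nat.ModEq, heq]⟩
      refine ⟨x * t + (m - 1), ?_⟩
      have e : (x * t + (m - 1) + 1) * y = (y * x) * t + m * y := by
        rw [add_assoc, Nat.sub_add_cancel hm]; ring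
      rw [e, ht]
      simpa using (hx.mul_right t).add (Nat.modEq_zero_iff_dvd.2 (dvd_mul_right m y))
    have hiff : ∀ a, (a + 1) * y ≡ c [MOD m] ↔ a ≡ a₀ [MOD m / m.gcd y] := fun a => by
      constructor
      · intro ha
        exact Nat.ModEq.add_right_cancel' 1 ((ha.trans ha₀.symm).cancel_right_div_gcd hm)
      · intro ha
        refine Nat.ModEq.trans ?_ ha₀
        have h1 := (ha.add_right 1).mul_right' y
        refine h1.of_dvd ?_
        calc m = m / m.gcd y * m.gcd y := (Nat.div_mul_cancel (Nat.gcd_dvd_left m y)).symm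
          _ ∣ m / m.gcd y * y := mul_dvd_mul_left _ (Nat.gcd_dvd_right m y)
    simp only [hiff]
    rw [← Nat.count_eq_card_filter_range, Nat.count_modEq_card _
      (Nat.div_pos (Nat.gcd_le_left y hm) hd)]
    rw [Nat.mod_eq_zero_of_dvd (Nat.div_dvd_of_dvd (Nat.gcd_dvd_left m y))]
    simp [Nat.div_div_self (Nat.gcd_dvd_left m y) hm.ne']
  · rw [card_eq_zero, filter_eq_empty_iff]
    intro a _ ha
    refine h (Nat.dvd_gcd (Nat.gcd_dvd_left m y) ?_)
    exact (ha.dvd_iff (Nat.gcd_dvd_left m y)).1 ((Nat.gcd_dvd_right m y).mul_left _)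

lemma digitProd_succ_modEq {m : ℕ} (hm : 0 < m) (s b : ℕ) {a : ℕ} (ha : a < m) :
    digitProd m (s + 1) (m * b + a) ≡ (a + 1) * digitProd m s b [MOD m] := by
  rw [digitProd_succ, Nat.mul_add_div hm, Nat.div_eq_of_lt ha, add_zero]
  refine Nat.ModEq.mul_right _ (Nat.ModEq.add_right 1 ?_)
  simp [Nat.ModEq]

lemma card_digitProd_succ {m : ℕ} (hm : 0 < m) (s c : ℕ) :
    #{n ∈ range (m ^ (s + 1)) | digitProd m (s + 1) n ≡ c [MOD m]} =
      ∑ b ∈ range (m ^ s),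
        if m.gcd (digitProd m s b) ∣ m.gcd c then m.gcd (digitProd m s b) else 0 := by
  rw [card_filter, pow_succ', sum_range_mul]
  refine sum_congr rfl fun b _ => ?_
  rw [← card_filter_succ_mul_modEq hm, card_filter]
  refine sum_congr rfl fun a ha => ?_
  have h := digitProd_succ_modEq hm s b (mem_range.1 ha)
  exact if_congr ⟨h.symm.trans, h.trans⟩ rfl rfl

lemma totient_mul_of_primes_dvd (d n : ℕ) (hd : d ≠ 0)
    (h : ∀ p, p.Prime → p ∣ d → p ∣ n) :
    Nat.totient (d * n) = d * Nat.totient n := by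
  induction d using Nat.recOnMul generalizing n with
  | zero => exact absurd rfl hd
  | one => simp
  | prime p hp => exact Nat.totient_mul_of_prime_of_dvd hp (h p hp dvd_rfl)
  | mul a b iha ihb =>
    have ha : a ≠ 0 := left_ne_zero_of_mul hd
    have hb : b ≠ 0 := right_ne_zero_of_mul hd
    rw [mul_assoc, iha (b * n) ha fun p hp hpa => (h p hp (hpa.mul_right b)).mul_left b,
      ihb n hb fun p hp hpb => h p hp (hpb.mul_left a), mul_assoc]

/-- The number of residue sequences of length `s + 1` whose product is a given residue `c`, under
the assumption that every prime factor of `gcd m c` divides `m / gcd m c`. -/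
lemma card_digitProd {m : ℕ} (hm : 0 < m) (s c : ℕ)
    (h : ∀ p, p.Prime → p ∣ m.gcd c → p ∣ m / m.gcd c) :
    #{n ∈ range (m ^ (s + 1)) | digitProd m (s + 1) n ≡ c [MOD m]} =
      Nat.totient m ^ s * (ArithmeticFunction.zeta ^ (s + 1)) (m.gcd c) := by
  have hc : m.gcd c ≠ 0 := (Nat.gcd_pos_of_pos_left c hm).ne'
  induction s generalizing c with
  | zero =>
    rw [card_digitProd_succ hm]
    simp [digitProd_zero, hc]
  | succ s ih =>
    rw [card_digitProd_succ hm, pow_succ ArithmeticFunction.zeta,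
      ArithmeticFunction.mul_zeta_apply, mul_sum, ← sum_filter,
      ← sum_fiberwise_of_maps_to (t := (m.gcd c).divisors)
        (g := fun b => m.gcd (digitProd m (s + 1) b))
        (fun b hb => Nat.mem_divisors.2 ⟨(mem_filter.1 hb).2, hc⟩)]
    refine sum_congr rfl fun d hd => ?_
    have hdc : d ∣ m.gcd c := Nat.dvd_of_mem_divisors hd
    have hdm : d ∣ m := hdc.trans (Nat.gcd_dvd_left m c)
    have hd0 : d ≠ 0 := ne_zero_of_dvd_ne_zero hc hdc
    have hprime : ∀ p, p.Prime → p ∣ d → p ∣ m / d := fun p hp hpd =>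
      (h p hp (hpd.trans hdc)).trans (Nat.div_dvd_div_left (Nat.gcd_dvd_left m c) hdc)
    have hcount : #{b ∈ range (m ^ (s + 1)) | m.gcd (digitProd m (s + 1) b) = d} =
        Nat.totient (m / d) *
          (Nat.totient m ^ s * (ArithmeticFunction.zeta ^ (s + 1)) d) := by
      rw [Nat.totient_div_of_dvd hdm, card_eq_sum_card_fiberwise
        (f := fun b => digitProd m (s + 1) b % m) (t := {y ∈ range m | m.gcd y = d}),
        ← smul_eq_mul, ← sum_const]
      · refine sum_congr rfl fun y hy => ?_
        obtain ⟨hym, rfl⟩ := mem_filter.1 hy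
        rw [← ih y hprime hd0, filter_filter]
        congr 1
        refine filter_congr fun b _ => ?_
        have hmod : digitProd m (s + 1) b ≡ y [MOD m] ↔ digitProd m (s + 1) b % m = y := by
          rw [Nat.ModEq, Nat.mod_eq_of_lt (mem_range.1 hym)]
        rw [hmod]
        refine ⟨fun hb => hb.2, fun hb => ⟨?_, hb⟩⟩
        rw [Nat.gcd_comm, Nat.gcd_comm m]
        exact (hmod.2 hb).gcd_eq
      · intro b hb
        have hb := (mem_filter.1 (mem_coe.1 hb)).2
        refine mem_coe.2 (mem_filter.2 ⟨mem_range.2 (Nat.mod_lt _ hm), ?_⟩)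
        rw [Nat.gcd_comm, ← hb, Nat.gcd_comm m]
        exact (Nat.mod_modEq _ _).gcd_eq
    rw [filter_filter, filter_congr (q := fun b => m.gcd (digitProd m (s + 1) b) = d)
        (fun b _ => ⟨fun hb => hb.2, fun hb => ⟨hb ▸ hdc, hb⟩⟩),
      sum_congr rfl (fun b hb => (mem_filter.1 hb).2), sum_const, hcount, smul_eq_mul]
    have ht : Nat.totient m = d * Nat.totient (m / d) := by
      rw [← totient_mul_of_primes_dvd d (m / d) hd0 hprime, Nat.mul_div_cancel' hdm]
    rw [pow_succ (Nat.totient m)]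
    generalize Nat.totient m ^ s = t
    rw [ht]
    ring

lemma zeta_pow_succ_apply_prime_pow {p : ℕ} (hp : p.Prime) (s a : ℕ) :
    (ArithmeticFunction.zeta ^ (s + 1)) (p ^ a) = (a + s).choose a := by
  induction s generalizing a with
  | zero => simp [hp.ne_zero]
  | succ s ih =>
    rw [pow_succ, ArithmeticFunction.mul_zeta_apply, Nat.sum_divisors_prime_pow hp]
    simp only [ih]
    have h := Nat.sum_range_add_choose a s
    simp only [Nat.choose_symm_add]
    rw [h, add_assoc, Nat.choose_symm_add]

lemma zeta_pow_succ_apply (s : ℕ) {n : ℕ} (hn : n ≠ 0) :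
    (ArithmeticFunction.zeta ^ (s + 1)) n =
      ∏ p ∈ n.primeFactors, (n.factorization p + s).choose (n.factorization p) := by
  have hmul : (ArithmeticFunction.zeta ^ (s + 1)).IsMultiplicative := by
    induction s with
    | zero => simpa using ArithmeticFunction.isMultiplicative_zeta
    | succ s ih => rw [pow_succ]; exact ih.mul ArithmeticFunction.isMultiplicative_zeta
  rw [ArithmeticFunction.IsMultiplicative.multiplicative_factorization _ hmul hn]
  exact prod_congr n.support_factorization fun p hp =>
    zeta_pow_succ_apply_prime_pow (Nat.prime_of_mem_primeFactors hp) s _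

lemma rM_add_two {m : ℕ} (hm : 0 < m) (s : ℕ) {i : ℕ} (hi : i < m) :
    rM i m (s + 2) =
      m * #{n ∈ range (m ^ (s + 1)) | digitProd m (s + 1) n ≡ i [MOD m]} := by
  rw [rM, card_filter, pow_succ', sum_range_mul, card_filter, mul_sum]
  refine sum_congr rfl fun b _ => ?_
  have h : ∀ a ∈ range m, (if pM m (s + 2) (m * b + a) % m = i then 1 else 0) =
      if digitProd m (s + 1) b ≡ i [MOD m] then 1 else 0 := fun a ha => by
    have hp := pM_succ_modEq_digitProd hm (s + 1) (m * b + a)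
    rw [Nat.mul_add_div hm, Nat.div_eq_of_lt (mem_range.1 ha), add_zero] at hp
    refine if_congr ?_ rfl rfl
    rw [show pM m (s + 2) _ % m = _ from hp, Nat.ModEq, Nat.mod_eq_of_lt hi]
  rw [sum_congr rfl h, sum_const, card_range, smul_eq_mul]

/-- If `i ⬝ rad(i) ∣ m`, then
`rM i m k = m ⬝ φ(m)^(k-2) ⬝ ∏_{p ∣ i} C(ν_p(i)+k-2, ν_p(i))`. -/
theorem stmt_18 (m k : ℕ) (hm : 2 ≤ m) (hk : 2 ≤ k) (i : ℕ) (hi : 2 ≤ i)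
    (hrad : i * (∏ p ∈ i.primeFactors, p) ∣ m) :
    rM i m k = m * Nat.totient m ^ (k - 2) *
      ∏ p ∈ i.primeFactors, Nat.choose (i.factorization p + k - 2) (i.factorization p) := by
  obtain ⟨s, rfl⟩ := Nat.exists_eq_add_of_le' hk
  have hm0 : 0 < m := by omega
  have hi0 : i ≠ 0 := by omega
  have him : i ∣ m := (dvd_mul_right _ _).trans hrad
  have hgcd : m.gcd i = i := Nat.gcd_eq_right him
  have hprime : ∀ p, p.Prime → p ∣ i → p ∣ m / i := fun p hp hpi =>
    (dvd_prod_of_mem (fun p => p) (Nat.mem_primeFactors.2 ⟨hp, hpi, hi0⟩)).trans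
      (Nat.dvd_div_of_mul_dvd hrad)
  have hlt : i < m := by
    refine lt_of_le_of_ne (Nat.le_of_dvd hm0 him) ?_
    rintro rfl
    have hp := Nat.minFac_prime (n := i) (by omega)
    have := hprime _ hp (Nat.minFac_dvd i)
    rw [Nat.div_self hm0] at this
    exact hp.one_lt.ne' (Nat.dvd_one.1 this)
  rw [rM_add_two hm0 s hlt, card_digitProd hm0 s i (by rwa [hgcd]), hgcd,
    zeta_pow_succ_apply s hi0, mul_assoc]
  simp only [← add_assoc, Nat.add_sub_cancel]
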